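/- There exists a finite set of 29768 unit vectors in the Euclidean space ℝ^21 such that the inner product of any two distinct vectors in the set is at most 1/2. (Equivalently, the kissing number in 21 dimensions is at least 29768.) -/

import Mathlib

open scoped RealInnerProductSpace

namespace Kiss

open Finset

/-- The contribution of one generator `b` of the code. -/
def tt (k b m : ℕ) : ℕ := if m.testBit k then b else 0

/-- The codewords (as 21-bit masks) of a shortened and punctured binary Golay code, of dimension 11.
The words with index below 512 form the subcode generated by octads missing three points. -/
def cw (m : ℕ) : ℕ :=
  tt 0 5279 m ^^^ (tt 1 15777 m ^^^ (tt 2 28637 m ^^^ (tt 3 52005 m ^^^ (tt 4 99029 m ^^^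
  (tt 5 201013 m ^^^ (tt 6 407285 m ^^^ (tt 7 817525 m ^^^ (tt 8 1631861 m ^^^
  (tt 9 1169525 m ^^^ tt 10 238709 m)))))))))

/-- The set of positions of a mask. -/
def S (n : ℕ) : Finset (Fin 21) := univ.filter (fun i => n.testBit i.1 = true)

theorem tt_xor (k b m n : ℕ) : tt k b (m ^^^ n) = tt k b m ^^^ tt k b n := by
  unfold tt
  rw [Nat.testBit_xor]
  cases m.testBit k <;> cases n.testBit k <;> simp

theorem cw_xor (m n : ℕ) : cw (m ^^^ n) = cw m ^^^ cw n := by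
  unfold cw
  simp only [tt_xor]
  ac_rfl

theorem S_xor (m n : ℕ) : S (m ^^^ n) = symmDiff (S m) (S n) := by
  ext i
  simp only [S, mem_filter, mem_univ, true_and, Nat.testBit_xor, mem_symmDiff]
  cases m.testBit i.1 <;> cases n.testBit i.1 <;> simp

theorem wt6_aux : ∀ a < 32, ∀ b < 64, 64 * a + b ≠ 0 → 6 ≤ (S (cw (64 * a + b))).card := by
  decide +kernel

theorem wt6 (m : ℕ) (hm : m < 2048) (h : m ≠ 0) : 6 ≤ (S (cw m)).card := by
  have := wt6_aux (m / 64) (by omega) (m % 64) (by omega)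
  rw [Nat.div_add_mod] at this
  exact this h

theorem wt8 : ∀ m < 512, m ≠ 0 → 8 ≤ (S (cw m)).card := by decide +kernel

/-- Indices of the octads. -/
def OI : Finset ℕ := (range 512).filter (fun m => (S (cw m)).card = 8)

theorem OI_card : OI.card = 210 := by decide +kernel

theorem card_symm (A B : Finset (Fin 21)) :
    (symmDiff A B).card + 2 * (A ∩ B).card = A.card + B.card := by
  have h1 : (symmDiff A B).card = (A \ B).card + (B \ A).card := by
    rw [symmDiff_def]
    exact card_union_of_disjoint disjoint_sdiff_sdiff
  have h2 := card_sdiff_add_card_inter A B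
  have h3 := card_sdiff_add_card_inter B A
  rw [inter_comm B A] at h3
  omega

theorem par_symm (O A B : Finset (Fin 21)) (hA : Even (O ∩ A).card) (hB : Even (O ∩ B).card) :
    Even (O ∩ symmDiff A B).card := by
  have h : O ∩ symmDiff A B = symmDiff (O ∩ A) (O ∩ B) := by
    ext i
    simp only [mem_inter, mem_symmDiff]
    tauto
  have := card_symm (O ∩ A) (O ∩ B)
  rw [h]
  rw [Nat.even_iff] at *
  omega

theorem par_tt (O : Finset (Fin 21)) (k b m : ℕ) (h : Even (O ∩ S b).card) :
    Even (O ∩ S (tt k b m)).card := by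
  unfold tt
  split
  · exact h
  · simp [S]

theorem par_basis : ∀ m < 512, ∀ b ∈ [5279, 15777, 28637, 52005, 99029, 201013, 407285, 817525,
    1631861, 1169525, 238709], Even (S (cw m) ∩ S b).card := by decide +kernel

theorem par (m : ℕ) (hm : m < 512) (n : ℕ) : Even (S (cw m) ∩ S (cw n)).card := by
  have h := par_basis m hm
  generalize S (cw m) = O at h
  simp only [List.forall_mem_cons] at h
  obtain ⟨h0, h1, h2, h3, h4, h5, h6, h7, h8, h9, h10, -⟩ := h
  unfold cw
  simp only [S_xor]
  repeat' apply par_symm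
  all_goals (apply par_tt; assumption)

theorem xor_lt {a b : ℕ} (n : ℕ) (ha : a < 2 ^ n) (hb : b < 2 ^ n) : a ^^^ b < 2 ^ n :=
  Nat.xor_lt_two_pow ha hb

theorem dist6 {m n : ℕ} (hm : m < 2048) (hn : n < 2048) (h : m ≠ n) :
    6 ≤ (symmDiff (S (cw m)) (S (cw n))).card := by
  rw [← S_xor, ← cw_xor]
  exact wt6 _ (xor_lt 11 hm hn) (by simpa [Nat.xor_eq_zero_iff] using h)

theorem dist8 {m n : ℕ} (hm : m ∈ OI) (hn : n ∈ OI) (h : m ≠ n) :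
    (S (cw m) ∩ S (cw n)).card ≤ 4 := by
  simp only [OI, mem_filter, mem_range] at hm hn
  have h1 := card_symm (S (cw m)) (S (cw n))
  have h2 : 8 ≤ (symmDiff (S (cw m)) (S (cw n))).card := by
    rw [← S_xor, ← cw_xor]
    exact wt8 _ (xor_lt 9 hm.1 hn.1) (by simpa [Nat.xor_eq_zero_iff] using h)
  omega

/-- The vector with entries `±a` supported on `O`, negative on `T`. -/
noncomputable def g (a : ℝ) (O T : Finset (Fin 21)) : EuclideanSpace ℝ (Fin 21) :=
  WithLp.toLp 2 (fun i => if i ∈ O then (if i ∈ T then -a else a) else 0)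

theorem inner_g (a b : ℝ) (O T P U : Finset (Fin 21)) :
    ⟪g a O T, g b P U⟫ =
      a * b * (((O ∩ P).card : ℝ) - 2 * (((O ∩ P) ∩ symmDiff T U).card : ℝ)) := by
  have h1 : ((O ∩ P).card : ℝ) = ∑ i, if i ∈ O ∩ P then (1 : ℝ) else 0 := by
    rw [Finset.sum_ite_mem]; simp
  have h2 : (((O ∩ P) ∩ symmDiff T U).card : ℝ) =
      ∑ i, if i ∈ (O ∩ P) ∩ symmDiff T U then (1 : ℝ) else 0 := by
    rw [Finset.sum_ite_mem]; simp
  rw [h1, h2, mul_sum, ← sum_sub_distrib, mul_sum]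
  simp only [g, PiLp.inner_apply]
  refine sum_congr rfl fun i _ => ?_
  simp only [mem_inter, mem_symmDiff]
  by_cases hO : i ∈ O <;> by_cases hP : i ∈ P <;> by_cases hT : i ∈ T <;>
    by_cases hU : i ∈ U <;> simp [hO, hP, hT, hU] <;> ring

theorem inner_g_le {a b : ℝ} (ha : 0 ≤ a) (hb : 0 ≤ b) {O T P U : Finset (Fin 21)} {k l : ℕ}
    (hk : (O ∩ P).card ≤ k + 2 * l) (hl : l ≤ ((O ∩ P) ∩ symmDiff T U).card) :
    ⟪g a O T, g b P U⟫ ≤ a * b * k := by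
  rw [inner_g]
  refine mul_le_mul_of_nonneg_left ?_ (mul_nonneg ha hb)
  have hk' : ((O ∩ P).card : ℝ) ≤ k + 2 * l := by exact_mod_cast hk
  have hl' : (l : ℝ) ≤ ((O ∩ P) ∩ symmDiff T U).card := by exact_mod_cast hl
  linarith

theorem norm_g {a : ℝ} {O T : Finset (Fin 21)} (h : a * a * O.card = 1) : ‖g a O T‖ = 1 := by
  have : ‖g a O T‖ ^ 2 = 1 := by
    rw [← real_inner_self_eq_norm_sq, inner_g]
    simpa using h
  nlinarith [norm_nonneg (g a O T)]

theorem family {ι : Type*} (s : Finset ι) (f : ι → EuclideanSpace ℝ (Fin 21))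
    (hn : ∀ i ∈ s, ‖f i‖ = 1) (hi : ∀ i ∈ s, ∀ j ∈ s, i ≠ j → ⟪f i, f j⟫ ≤ (1 : ℝ) / 2) :
    ∃ V : Finset (EuclideanSpace ℝ (Fin 21)), V.card = s.card ∧ (∀ v ∈ V, ‖v‖ = 1) ∧
      (∀ v ∈ V, ∀ w ∈ V, v ≠ w → ⟪v, w⟫ ≤ (1 : ℝ) / 2) := by
  classical
  refine ⟨s.image f, card_image_of_injOn ?_, ?_, ?_⟩
  · intro i his j hjs hij
    by_contra hne
    have h := hi i his j hjs hne
    rw [← hij, real_inner_self_eq_norm_sq, hn i his] at h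
    norm_num at h
  · simpa using hn
  · simp only [mem_image]
    rintro _ ⟨i, his, rfl⟩ _ ⟨j, hjs, rfl⟩ hne
    exact hi i his j hjs (fun h => hne (by rw [h]))

theorem odd_subsets (O : Finset (Fin 21)) (h : O.card = 8) :
    (O.powerset.filter (fun T => Odd T.card)).card = 128 := by
  have : O.powerset.filter (fun T => Odd T.card) =
      ({1, 3, 5, 7} : Finset ℕ).biUnion (fun k => O.powersetCard k) := by
    ext T
    simp only [mem_filter, mem_powerset, mem_biUnion, mem_powersetCard]
    constructor
    · rintro ⟨hT, hodd⟩
      refine ⟨T.card, ?_, hT, rfl⟩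
      have := card_le_card hT
      rw [Nat.odd_iff] at hodd
      simp only [mem_insert, mem_singleton]
      omega
    · rintro ⟨k, hk, hT, rfl⟩
      refine ⟨hT, ?_⟩
      rw [Nat.odd_iff]
      simp only [mem_insert, mem_singleton] at hk
      omega
  rw [this, card_biUnion]
  · simp only [card_powersetCard, h]
    decide
  · intro x _ y _ hxy
    exact pairwise_disjoint_powersetCard O hxy

/-- Octad vectors: octad index and an odd set of minus signs. -/
def I1 : Finset (Σ _ : ℕ, Finset (Fin 21)) :=
  OI.sigma (fun m => (S (cw m)).powerset.filter (fun T => Odd T.card))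

/-- Vectors with two nonzero entries. -/
def I2 : Finset (Σ _ : Finset (Fin 21), Finset (Fin 21)) :=
  (powersetCard 2 univ).sigma (fun O => O.powerset)

theorem I1_card : I1.card = 26880 := by
  rw [I1, card_sigma, sum_const_nat (m := 128), OI_card]
  intro m hm
  exact odd_subsets _ (mem_filter.1 hm).2

theorem I2_card : I2.card = 840 := by
  rw [I2, card_sigma, sum_const_nat (m := 4), card_powersetCard]
  · simp [Nat.choose]
  intro O hO
  rw [card_powerset, (mem_powersetCard.1 hO).2]
  norm_num

theorem sqrt_mul_le {x y : ℝ} {k : ℕ} (hx : 0 ≤ x) (h : x * y * k ^ 2 ≤ 1 / 4) :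
    √x * √y * k ≤ 1 / 2 := by
  rw [← Real.sqrt_mul hx]
  refine abs_le_of_sq_le_sq' (a := √(x * y) * k) (b := 1 / 2) ?_ (by norm_num) |>.2
  by_cases hxy : 0 ≤ x * y
  · rw [mul_pow, Real.sq_sqrt hxy]
    linarith
  · rw [Real.sqrt_eq_zero_of_nonpos (le_of_not_ge hxy)]
    norm_num

/-- The vector attached to an index. -/
noncomputable def f : (Σ _ : ℕ, Finset (Fin 21)) ⊕
    ((Σ _ : Finset (Fin 21), Finset (Fin 21)) ⊕ ℕ) → EuclideanSpace ℝ (Fin 21)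
  | .inl p => g (√(1 / 8)) (S (cw p.1)) p.2
  | .inr (.inl p) => g (√(1 / 2)) p.1 p.2
  | .inr (.inr n) => g (√(1 / 21)) univ (S (cw n))

theorem ip_le {x y : ℝ} {O T P U : Finset (Fin 21)} (k l : ℕ) (hx : 0 ≤ x)
    (h : x * y * k ^ 2 ≤ 1 / 4)
    (hk : (O ∩ P).card ≤ k + 2 * l) (hl : l ≤ ((O ∩ P) ∩ symmDiff T U).card) :
    ⟪g (√x) O T, g (√y) P U⟫ ≤ 1 / 2 :=
  (inner_g_le (Real.sqrt_nonneg _) (Real.sqrt_nonneg _) hk hl).trans (sqrt_mul_le hx h)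

theorem mem_I1 {p : Σ _ : ℕ, Finset (Fin 21)} : p ∈ I1 ↔
    p.1 < 512 ∧ (S (cw p.1)).card = 8 ∧ p.2 ⊆ S (cw p.1) ∧ Odd p.2.card := by
  simp [I1, OI, and_assoc]

theorem mem_I2 {p : Σ _ : Finset (Fin 21), Finset (Fin 21)} : p ∈ I2 ↔ p.1.card = 2 ∧ p.2 ⊆ p.1 := by
  simp [I2]

attribute [irreducible] I1 I2 cw S

theorem symm_inter {O T U : Finset (Fin 21)} (hT : T ⊆ O) (hU : U ⊆ O) :
    (O ∩ O) ∩ symmDiff T U = symmDiff T U := by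
  rw [inter_self]
  apply inter_eq_right.2
  intro i hi
  rcases mem_symmDiff.1 hi with h | h
  · exact hT h.1
  · exact hU h.1

theorem symm_pos {T U : Finset (Fin 21)} (h : T ≠ U) : 0 < (symmDiff T U).card := by
  rw [card_pos, nonempty_iff_ne_empty]
  intro h'
  exact h (symmDiff_eq_bot.1 h')

theorem ip11 {p q : Σ _ : ℕ, Finset (Fin 21)} (hp : p ∈ I1) (hq : q ∈ I1) (h : p ≠ q) :
    ⟪f (.inl p), f (.inl q)⟫ ≤ (1 : ℝ) / 2 := by
  obtain ⟨m, T⟩ := p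
  obtain ⟨n, U⟩ := q
  obtain ⟨p1, p2, p3, p4⟩ := mem_I1.1 hp
  obtain ⟨q1, q2, q3, q4⟩ := mem_I1.1 hq
  dsimp only at p1 p2 p3 p4 q1 q2 q3 q4
  by_cases hmn : m = n
  · subst hmn
    have hTU : T ≠ U := fun e => h (by rw [e])
    refine ip_le 4 2 (by norm_num) (by norm_num) ?_ ?_
    · dsimp only
      rw [inter_self, p2]
    · dsimp only
      rw [symm_inter p3 q3]
      have h1 := symm_pos hTU
      have h2 := card_symm T U
      rw [Nat.odd_iff] at p4 q4
      omega
  · refine ip_le 4 0 (by norm_num) (by norm_num) ?_ (Nat.zero_le _)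
    exact dist8 (by simp [OI, p1, p2]) (by simp [OI, q1, q2]) hmn

theorem ip12 {p : Σ _ : ℕ, Finset (Fin 21)} {q : Σ _ : Finset (Fin 21), Finset (Fin 21)} (hq : q ∈ I2) :
    ⟪f (.inl p), f (.inr (.inl q))⟫ ≤ (1 : ℝ) / 2 := by
  refine ip_le 2 0 (by norm_num) (by norm_num) ?_ (Nat.zero_le _)
  exact (card_le_card inter_subset_right).trans (mem_I2.1 hq).1.le

theorem ip13 {p : Σ _ : ℕ, Finset (Fin 21)} {n : ℕ} (hp : p ∈ I1) :
    ⟪f (.inl p), f (.inr (.inr n))⟫ ≤ (1 : ℝ) / 2 := by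
  obtain ⟨m, T⟩ := p
  obtain ⟨p1, p2, p3, p4⟩ := mem_I1.1 hp
  dsimp only at p1 p2 p3 p4
  have hpar := par m p1 n
  refine ip_le 6 1 (by norm_num) (by norm_num) ?_ ?_
  · dsimp only
    rw [inter_univ, p2]
  · dsimp only
    rw [inter_univ]
    by_contra hlt
    have h0 : (S (cw m) ∩ symmDiff T (S (cw n))).card = 0 := by omega
    have he : S (cw m) ∩ symmDiff T (S (cw n)) = symmDiff T (S (cw m) ∩ S (cw n)) := by
      ext i
      have := @p3 i
      simp only [mem_inter, mem_symmDiff]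
      tauto
    rw [he] at h0
    have h2 := card_symm T (S (cw m) ∩ S (cw n))
    rw [Nat.odd_iff] at p4
    rw [Nat.even_iff] at hpar
    omega

theorem ip22 {p q : Σ _ : Finset (Fin 21), Finset (Fin 21)} (hp : p ∈ I2) (hq : q ∈ I2) (h : p ≠ q) :
    ⟪f (.inr (.inl p)), f (.inr (.inl q))⟫ ≤ (1 : ℝ) / 2 := by
  obtain ⟨O, T⟩ := p
  obtain ⟨P, U⟩ := q
  obtain ⟨p1, p2⟩ := mem_I2.1 hp
  obtain ⟨q1, q2⟩ := mem_I2.1 hq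
  dsimp only at p1 p2 q1 q2
  by_cases hOP : O = P
  · subst hOP
    have hTU : T ≠ U := fun e => h (by rw [e])
    refine ip_le 0 1 (by norm_num) (by norm_num) ?_ ?_
    · dsimp only
      rw [inter_self, p1]
    · dsimp only
      rw [symm_inter p2 q2]
      exact symm_pos hTU
  · refine ip_le 1 0 (by norm_num) (by norm_num) ?_ (Nat.zero_le _)
    have h1 := card_symm O P
    have h2 := symm_pos hOP
    dsimp only
    omega

theorem ip23 {p : Σ _ : Finset (Fin 21), Finset (Fin 21)} {n : ℕ} (hp : p ∈ I2) :
    ⟪f (.inr (.inl p)), f (.inr (.inr n))⟫ ≤ (1 : ℝ) / 2 := by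
  refine ip_le 2 0 (by norm_num) (by norm_num) ?_ (Nat.zero_le _)
  exact (card_le_card inter_subset_left).trans (mem_I2.1 hp).1.le

theorem ip33 {m n : ℕ} (hm : m < 2048) (hn : n < 2048) (h : m ≠ n) :
    ⟪f (.inr (.inr m)), f (.inr (.inr n))⟫ ≤ (1 : ℝ) / 2 := by
  refine ip_le 9 6 (by norm_num) (by norm_num) ?_ ?_
  · simp
  · rw [inter_self, univ_inter]
    exact dist6 hm hn h

end Kiss

/-- The kissing number in 21 dimensions is at least 29768: there is a set of 29768 unit
vectors in Euclidean space ℝ^21 whose pairwise inner products are at most 1/2. -/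
theorem kissing_dim21_ge_29768 :
    ∃ V : Finset (EuclideanSpace ℝ (Fin 21)),
      V.card = 29768 ∧
      (∀ v ∈ V, ‖v‖ = 1) ∧
      (∀ v ∈ V, ∀ w ∈ V, v ≠ w → ⟪v, w⟫ ≤ (1 : ℝ) / 2) := by
  have hcard : (Kiss.I1.disjSum (Kiss.I2.disjSum (Finset.range 2048))).card = 29768 := by
    rw [Finset.card_disjSum, Finset.card_disjSum, Kiss.I1_card, Kiss.I2_card, Finset.card_range]
  rw [← hcard]
  apply Kiss.family _ Kiss.f
  · rintro (p | p | n) h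
    · have h1 := (Kiss.mem_I1.1 (Finset.inl_mem_disjSum.1 h)).2.1
      apply Kiss.norm_g
      rw [h1, Real.mul_self_sqrt (by norm_num)]
      norm_num
    · have h1 := (Kiss.mem_I2.1 (Finset.inl_mem_disjSum.1 (Finset.inr_mem_disjSum.1 h))).1
      apply Kiss.norm_g
      rw [h1, Real.mul_self_sqrt (by norm_num)]
      norm_num
    · apply Kiss.norm_g
      rw [Real.mul_self_sqrt (by norm_num)]
      norm_num
  · rintro (p | p | m) hp (q | q | n) hq hne <;>
      simp only [Finset.inl_mem_disjSum, Finset.inr_mem_disjSum, Finset.mem_range] at hp hq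
    · exact Kiss.ip11 hp hq (fun e => hne (by rw [e]))
    · exact Kiss.ip12 hq
    · exact Kiss.ip13 hp
    · rw [real_inner_comm]
      exact Kiss.ip12 hp
    · exact Kiss.ip22 hp hq (fun e => hne (by rw [e]))
    · exact Kiss.ip23 hp
    · rw [real_inner_comm]
      exact Kiss.ip13 hq
    · rw [real_inner_comm]
      exact Kiss.ip23 hq
    · exact Kiss.ip33 hp hq (fun e => hne (by rw [e]))
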